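/- Let R be an integral domain with quotient field K. Then R is a PvMD if and only if for every intermediate ring T with R ⊆ T ⊆ K and every maximal w-ideal 𝔪 of R (which is prime), the natural ring map R_𝔪 → T_𝔪 (where T_𝔪 denotes the localization of T at the multiplicative set R ∖ 𝔪) is a flat ring epimorphism, i.e., T_𝔪 is flat as an R_𝔪-module and the multiplication map T_𝔪 ⊗_{R_𝔪} T_𝔪 → T_𝔪 is bijective. -/

import Mathlib

open TensorProduct

/-- A finitely generated ideal `J` is a GV-ideal if the natural map
`R → Hom_R(J, R)`, sending `r` to multiplication by `r`, is bijective. -/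
def IsGVIdeal {R : Type*} [CommRing R] (J : Ideal R) : Prop :=
  J.FG ∧ Function.Bijective fun r : R => (r • J.subtype : J →ₗ[R] R)

/-- An ideal `I` of `R` is a `w`-ideal if `x ∈ I` whenever `Jx ⊆ I`
for some GV-ideal `J`. -/
def IsWIdeal {R : Type*} [CommRing R] (I : Ideal R) : Prop :=
  ∀ (J : Ideal R) (x : R), IsGVIdeal J → (∀ j ∈ J, j * x ∈ I) → x ∈ I

/-- A maximal `w`-ideal is an ideal maximal among proper `w`-ideals of `R`. -/
def IsMaximalWIdeal {R : Type*} [CommRing R] (I : Ideal R) : Prop :=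
  I ≠ ⊤ ∧ IsWIdeal I ∧ ∀ I' : Ideal R, IsWIdeal I' → I' ≠ ⊤ → I ≤ I' → I' = I

/-- `R` is a PvMD if for every nonzero finitely generated ideal `I` of `R` there is a
GV-ideal `J` with `J ⊆ I·I⁻¹` (inside the quotient field `K`). -/
def IsPvMD (R : Type*) [CommRing R] [IsDomain R] (K : Type*) [Field K] [Algebra R K]
    [IsFractionRing R K] : Prop :=
  ∀ I : Ideal R, I ≠ ⊥ → I.FG →
    ∃ J : Ideal R, IsGVIdeal J ∧
      (J : FractionalIdeal (nonZeroDivisors R) K) ≤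
        (I : FractionalIdeal (nonZeroDivisors R) K) *
          (I : FractionalIdeal (nonZeroDivisors R) K)⁻¹

section GVIdeal

variable {R : Type*} [CommRing R] [IsDomain R]

theorem IsGVIdeal.ne_bot {J : Ideal R} (hJ : IsGVIdeal J) : J ≠ ⊥ := by
  rintro rfl
  refine zero_ne_one (α := R) (hJ.2.1 (LinearMap.ext fun j => ?_))
  have hj : (j : R) = 0 := Ideal.mem_bot.1 j.2
  simp [hj]

/-- A GV-ideal has trivial inverse, phrased without reference to the quotient field. -/
theorem IsGVIdeal.dvd_of_forall_dvd {J : Ideal R} (hJ : IsGVIdeal J) {a b : R} (hb : b ≠ 0)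
    (h : ∀ j ∈ J, b ∣ a * j) : b ∣ a := by
  choose f hf using fun j : J => h j j.2
  let F : J →ₗ[R] R :=
    { toFun := f
      map_add' := fun x y => mul_left_cancel₀ hb (by
        rw [mul_add, ← hf, ← hf, ← hf]; simp [mul_add])
      map_smul' := fun r x => mul_left_cancel₀ hb (by
        have h1 := hf x
        have h2 := hf (r • x)
        simp only [Submodule.coe_smul, smul_eq_mul, RingHom.id_apply] at h1 h2 ⊢
        linear_combination r * h1 - h2) }
  obtain ⟨r, hr⟩ := hJ.2.2 F
  obtain ⟨j, hj, hj0⟩ := Submodule.exists_mem_ne_zero_of_ne_bot hJ.ne_bot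
  have h1 : r * j = f ⟨j, hj⟩ := by simpa [F] using LinearMap.congr_fun hr ⟨j, hj⟩
  refine ⟨r, mul_right_cancel₀ hj0 ?_⟩
  have h2 : a * j = b * f ⟨j, hj⟩ := hf ⟨j, hj⟩
  rw [h2, ← h1, mul_assoc]

theorem isGVIdeal_of_forall_dvd {J : Ideal R} (hfg : J.FG) (h0 : J ≠ ⊥)
    (h : ∀ a b : R, b ≠ 0 → (∀ j ∈ J, b ∣ a * j) → b ∣ a) : IsGVIdeal J := by
  obtain ⟨j, hj, hj0⟩ := Submodule.exists_mem_ne_zero_of_ne_bot h0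
  refine ⟨hfg, fun r s hrs => ?_, fun f => ?_⟩
  · have := LinearMap.congr_fun hrs ⟨j, hj⟩
    exact mul_right_cancel₀ hj0 (by simpa using this)
  · have key : ∀ i : J, f ⟨j, hj⟩ * i = j * f i := fun i => by
      have h1 : f ((i : R) • ⟨j, hj⟩) = f (j • i) := by
        congr 1
        exact Subtype.ext (mul_comm _ _)
      rw [map_smul, map_smul, smul_eq_mul, smul_eq_mul] at h1
      rw [mul_comm, h1]
    obtain ⟨r, hr⟩ := h (f ⟨j, hj⟩) j hj0 fun i hi => ⟨_, key ⟨i, hi⟩⟩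
    refine ⟨r, LinearMap.ext fun i => mul_left_cancel₀ hj0 ?_⟩
    rw [← key i, hr]
    simp [mul_assoc]

theorem isGVIdeal_top : IsGVIdeal (⊤ : Ideal R) :=
  isGVIdeal_of_forall_dvd ⟨{1}, by simp⟩ top_ne_bot fun a b _ h => by
    simpa using h 1 trivial

theorem IsGVIdeal.mul {I J : Ideal R} (hI : IsGVIdeal I) (hJ : IsGVIdeal J) :
    IsGVIdeal (I * J) :=
  isGVIdeal_of_forall_dvd (hI.1.mul hJ.1) (mul_ne_zero hI.ne_bot hJ.ne_bot) fun a b hb h =>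
    hI.dvd_of_forall_dvd hb fun i hi => hJ.dvd_of_forall_dvd hb fun j hj => by
      rw [mul_assoc]
      exact h _ (Ideal.mul_mem_mul hi hj)

omit [IsDomain R] in
/-- A proper `w`-ideal contains no GV-ideal. -/
theorem IsWIdeal.not_le {I J : Ideal R} (hI : IsWIdeal I) (h : I ≠ ⊤) (hJ : IsGVIdeal J) :
    ¬ J ≤ I := fun hle =>
  h ((Ideal.eq_top_iff_one I).2 (hI J 1 hJ fun j hj => by simpa using hle hj))

/-- An ideal containing no GV-ideal lies in a prime maximal `w`-ideal. -/
theorem exists_isMaximalWIdeal_isPrime_le (I : Ideal R)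
    (hI : ∀ J : Ideal R, IsGVIdeal J → ¬ J ≤ I) :
    ∃ P : Ideal R, IsMaximalWIdeal P ∧ P.IsPrime ∧ I ≤ P := by
  obtain ⟨P, hIP, hP, hmax⟩ := zorn_le_nonempty₀ {P : Ideal R | ∀ J, IsGVIdeal J → ¬ J ≤ P}
    (fun c hc hchain y hy => ⟨sSup c, fun J hJ hle => by
      obtain ⟨P, hP, hJP⟩ :=
        (CompleteLattice.isCompactElement_iff_le_of_directed_sSup_le _ _).1
          ((Submodule.fg_iff_compact J).1 hJ.1) c ⟨y, hy⟩ hchain.directedOn hle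
      exact hc hP J hJ hJP, fun z hz => le_sSup hz⟩) I hI
  have hne : P ≠ ⊤ := fun h => hP ⊤ isGVIdeal_top h.ge
  have hex : ∀ x, x ∉ P → ∃ J, IsGVIdeal J ∧ J ≤ P ⊔ Ideal.span {x} := fun x hx => by
    by_contra! hcon
    exact hx (hmax (y := P ⊔ Ideal.span {x}) hcon le_sup_left
      (Ideal.mem_sup_right (Ideal.mem_span_singleton_self x)))
  refine ⟨P, ⟨hne, fun J x hJ hx => ?_, fun Q hQ hQne hPQ =>
    le_antisymm (hmax (fun J hJ => hQ.not_le hQne hJ) hPQ) hPQ⟩, ⟨hne, fun {x y} hxy => ?_⟩, hIP⟩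
  · by_contra hxP
    obtain ⟨J', hJ', hle⟩ := hex x hxP
    refine hP _ (hJ'.mul hJ) (Ideal.mul_le.2 fun i hi j hj => ?_)
    obtain ⟨p, hp, q, hq, rfl⟩ := Submodule.mem_sup.1 (hle hi)
    obtain ⟨r, rfl⟩ := Ideal.mem_span_singleton'.1 hq
    rw [add_mul]
    refine P.add_mem (P.mul_mem_right _ hp) ?_
    rw [mul_assoc, mul_comm x]
    exact P.mul_mem_left _ (hx j hj)
  · by_contra! hcon
    obtain ⟨J, hJ, hle⟩ := hex x hcon.1
    obtain ⟨J', hJ', hle'⟩ := hex y hcon.2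
    refine hP _ (hJ.mul hJ') ((Ideal.mul_mono hle hle').trans ?_)
    rw [Ideal.sup_mul, Ideal.mul_sup (Ideal.span {x}), Ideal.span_singleton_mul_span_singleton]
    exact sup_le Ideal.mul_le_left (sup_le Ideal.mul_le_right
      ((Ideal.span_singleton_le_iff_mem P).2 hxy))

end GVIdeal

section LocallyValuation

variable {R : Type*} [CommRing R] [IsDomain R] {K : Type*} [Field K] [Algebra R K]
  [IsFractionRing R K]

theorem IsPvMD.dvd_total (h : IsPvMD R K) {𝔪 : Ideal R} (hm : IsMaximalWIdeal 𝔪) [𝔪.IsPrime]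
    (a b : R) : ∃ s ∉ 𝔪, a ∣ s * b ∨ b ∣ s * a := by
  have h1 : (1 : R) ∉ 𝔪 := (Ideal.ne_top_iff_one 𝔪).1 hm.1
  by_cases ha : a = 0
  · exact ⟨1, h1, Or.inr (by simp [ha])⟩
  have hI0 : Ideal.span {a, b} ≠ ⊥ := fun h0 =>
    ha (by simpa using h0.le (Ideal.subset_span (Set.mem_insert a {b})))
  obtain ⟨J, hJ, hle⟩ := h (Ideal.span {a, b}) hI0 
    (Submodule.fg_span (Set.toFinite _))
  by_contra! hcon
  refine hm.2.1.not_le hm.1 hJ ?_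
  have hle' : (J : FractionalIdeal (nonZeroDivisors R) K) ≤
      (𝔪 : FractionalIdeal (nonZeroDivisors R) K) := by
    refine hle.trans (FractionalIdeal.mul_le.2 fun i hi u hu => ?_)
    have hu' := (FractionalIdeal.mem_inv_iff (FractionalIdeal.coeIdeal_ne_zero.2 hI0)).1 hu
    obtain ⟨p, hp⟩ := FractionalIdeal.mem_one_iff _ |>.1
      (hu' _ (FractionalIdeal.mem_coeIdeal_of_mem _ (Ideal.subset_span (Set.mem_insert a {b}))))
    obtain ⟨q, hq⟩ := FractionalIdeal.mem_one_iff _ |>.1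
      (hu' (algebraMap R K b) (FractionalIdeal.mem_coeIdeal_of_mem _
        (Ideal.subset_span (Set.mem_insert_of_mem a rfl))))
    have hpq : p * b = a * q := IsFractionRing.injective R K (by
      rw [map_mul, map_mul, hp, hq]; ring)
    have hpm : p ∈ 𝔪 := by
      by_contra hc
      exact (hcon p hc).1 ⟨q, hpq⟩
    have hqm : q ∈ 𝔪 := by
      by_contra hc
      exact (hcon q hc).2 ⟨p, by linear_combination -hpq⟩
    obtain ⟨i, hi', rfl⟩ := (FractionalIdeal.mem_coeIdeal _).1 hi
    obtain ⟨c, d, rfl⟩ := Ideal.mem_span_pair.1 hi'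
    refine (FractionalIdeal.mem_coeIdeal _).2
      ⟨c * p + d * q, 𝔪.add_mem (𝔪.mul_mem_left _ hpm) (𝔪.mul_mem_left _ hqm), ?_⟩
    simp only [map_add, map_mul, hp, hq]
    ring
  exact (FractionalIdeal.coeIdeal_le_coeIdeal K).1 hle'

omit [IsDomain R] in
theorem Ideal.FG.exists_mem_forall_dvd {𝔪 : Ideal R} [h𝔪 : 𝔪.IsPrime]
    (h : ∀ a b : R, ∃ s ∉ 𝔪, a ∣ s * b ∨ b ∣ s * a) {I : Ideal R} (hI : I.FG) :
    ∃ a ∈ I, ∃ s ∉ 𝔪, ∀ i ∈ I, a ∣ s * i := by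
  refine Submodule.fg_induction (motive := fun I _ => ∃ a ∈ I, ∃ s ∉ 𝔪, ∀ i ∈ I, a ∣ s * i)
    (fun x => ⟨x, Submodule.mem_span_singleton_self x, 1, h𝔪.one_notMem, fun i hi => ?_⟩)
    ?_ I hI
  · simpa using Ideal.mem_span_singleton.1 hi
  · rintro I₁ I₂ - - ⟨a, ha, s, hs, hdvd⟩ ⟨b, hb, t, ht, hdvd'⟩
    have aux : ∀ r ∉ 𝔪, s * t * r ∉ 𝔪 := fun r hr hmem =>
      (h𝔪.mem_or_mem hmem).elim (fun h => (h𝔪.mem_or_mem h).elim hs ht) hr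
    obtain ⟨r, hr, hab | hab⟩ := h a b
    · refine ⟨a, Submodule.mem_sup_left ha, s * t * r, aux r hr, fun i hi => ?_⟩
      obtain ⟨x, hx, y, hy, rfl⟩ := Submodule.mem_sup.1 hi
      rw [mul_add]
      refine dvd_add ?_ ?_
      · convert (hdvd x hx).mul_right (t * r) using 1; ring
      · convert (hab.trans (mul_dvd_mul_left r (hdvd' y hy))).mul_right s using 1; ring
    · refine ⟨b, Submodule.mem_sup_right hb, s * t * r, aux r hr, fun i hi => ?_⟩
      obtain ⟨x, hx, y, hy, rfl⟩ := Submodule.mem_sup.1 hi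
      rw [mul_add]
      refine dvd_add ?_ ?_
      · convert (hab.trans (mul_dvd_mul_left r (hdvd x hx))).mul_right t using 1; ring
      · convert (hdvd' y hy).mul_right (s * r) using 1; ring

theorem isPvMD_of_dvd_total (h : ∀ 𝔪 : Ideal R, IsMaximalWIdeal 𝔪 → 𝔪.IsPrime →
    ∀ a b : R, ∃ s ∉ 𝔪, a ∣ s * b ∨ b ∣ s * a) : IsPvMD R K := by
  intro I hI0 hI
  obtain ⟨D, hD⟩ : ∃ D : Ideal R, (D : FractionalIdeal (nonZeroDivisors R) K) =
      I * (I : FractionalIdeal (nonZeroDivisors R) K)⁻¹ :=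
    FractionalIdeal.le_one_iff_exists_coeIdeal.1 (by
      rw [FractionalIdeal.inv_eq]
      exact FractionalIdeal.mul_one_div_le_one)
  rw [← hD]
  by_contra! hcon
  obtain ⟨P, hP, hprime, hle⟩ := exists_isMaximalWIdeal_isPrime_le D fun J hJ hJD =>
    hcon J hJ (FractionalIdeal.coeIdeal_le_coeIdeal K |>.2 hJD)
  obtain ⟨a, ha, s, hs, hdvd⟩ := hI.exists_mem_forall_dvd (h P hP hprime)
  have ha0 : a ≠ 0 := by
    rintro rfl
    refine hI0 (eq_bot_iff.2 fun i hi => ?_)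
    have := hdvd i hi
    rw [zero_dvd_iff, mul_eq_zero] at this
    exact this.resolve_left fun h0 => hs (h0 ▸ P.zero_mem)
  have haK : algebraMap R K a ≠ 0 := by simpa using ha0
  refine hs (hle ?_)
  have hmem : algebraMap R K s ∈ (D : FractionalIdeal (nonZeroDivisors R) K) := by
    rw [hD, ← mul_div_cancel₀ (algebraMap R K s) haK]
    refine FractionalIdeal.mul_mem_mul (FractionalIdeal.mem_coeIdeal_of_mem _ ha) ?_
    rw [FractionalIdeal.mem_inv_iff (FractionalIdeal.coeIdeal_ne_zero.2 hI0)]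
    intro y hy
    obtain ⟨i, hi, rfl⟩ := (FractionalIdeal.mem_coeIdeal _).1 hy
    obtain ⟨r, hr⟩ := hdvd i hi
    refine (FractionalIdeal.mem_one_iff _).2 ⟨r, ?_⟩
    rw [div_mul_eq_mul_div, eq_div_iff haK, ← map_mul, ← map_mul, hr, mul_comm]
  obtain ⟨d, hd, hds⟩ := (FractionalIdeal.mem_coeIdeal _).1 hmem
  rwa [IsFractionRing.injective R K hds] at hd

end LocallyValuation

section FlatOverring

open Polynomial

variable {A : Type*} [CommRing A] {K : Type*} [Field K] [Algebra A K]

/-- If an overring `N` is flat, then the ideal of denominators of each `x ∈ N` generates the unit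
ideal of `N`. -/
theorem Subalgebra.exists_sum_smul_eq_one_of_flat [IsDomain A] [IsFractionRing A K]
    (N : Subalgebra A K) [Module.Flat A N]
    {x : K} (hx : x ∈ N) : ∃ (k : ℕ) (c : Fin k → A) (y : Fin k → K), (∀ j, y j ∈ N) ∧
      (∀ j, IsLocalization.IsInteger A (c j • x)) ∧ ∑ j, c j • y j = 1 := by
  obtain ⟨a, b, hb, rfl⟩ := IsFractionRing.div_surjective (A := A) x
  have hb0 : algebraMap A K b ≠ 0 := by simpa using nonZeroDivisors.ne_zero hb
  obtain ⟨k, c, y, hxy, hc⟩ := Module.Flat.isTrivialRelation_of_sum_smul_eq_zero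
    (f := ![a, -b]) (x := ![(1 : N), ⟨_, hx⟩]) (by
      refine Subtype.ext ?_
      simp [Fin.sum_univ_two, Algebra.smul_def, mul_div_cancel₀ _ hb0])
  refine ⟨k, c 0, fun j => y j, fun j => (y j).2, fun j => ⟨c 1 j, ?_⟩, ?_⟩
  · have h := congrArg (algebraMap A K) (hc j)
    simp only [Fin.sum_univ_two, Matrix.cons_val_zero, Matrix.cons_val_one, map_add, map_mul,
      map_neg, map_zero] at h
    rw [Algebra.smul_def, mul_div_assoc', eq_div_iff hb0]
    linear_combination -h
  · have h := congrArg (N.val) (hxy 0)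
    simpa using h.symm

theorem IsLocalization.IsInteger.of_isUnit_smul {c : A} (hc : IsUnit c) {x : K}
    (h : IsLocalization.IsInteger A (c • x)) : IsLocalization.IsInteger A x := by
  obtain ⟨u, rfl⟩ := hc
  simpa [smul_smul] using IsLocalization.isInteger_smul (a := (↑u⁻¹ : A)) h

variable [IsLocalRing A]

theorem isInteger_of_isIntegral_of_flat [IsDomain A] [IsFractionRing A K]
    {x : K} (hint : IsIntegral A x) [Module.Flat A (Algebra.adjoin A {x})] :
    IsLocalization.IsInteger A x := by
  obtain ⟨k, c, y, hy, hc, h1⟩ := (Algebra.adjoin A {x}).exists_sum_smul_eq_one_of_flat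
    (Algebra.self_mem_adjoin_singleton A x)
  by_contra hcon
  have hmem : ∀ j, c j ∈ IsLocalRing.maximalIdeal A := fun j =>
    (IsLocalRing.mem_maximalIdeal _).2 fun hu => hcon ((hc j).of_isUnit_smul hu)
  have hbot := Submodule.eq_bot_of_le_smul_of_le_jacobson_bot (IsLocalRing.maximalIdeal A)
    (Subalgebra.toSubmodule (Algebra.adjoin A {x})) hint.fg_adjoin_singleton
    (fun t ht => by
      have ht' : t = ∑ j, c j • (y j * t) := by
        simp_rw [← smul_mul_assoc, ← Finset.sum_mul, h1, one_mul]
      rw [ht']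
      exact Submodule.sum_mem _ fun j _ => Submodule.smul_mem_smul (hmem j)
        ((Algebra.adjoin A {x}).mul_mem (hy j) ht))
    (IsLocalRing.maximalIdeal_le_jacobson _)
  exact one_ne_zero ((Submodule.mem_bot A).1
    (hbot.le ((Subalgebra.mem_toSubmodule _).2 (Algebra.adjoin A {x}).one_mem)))

theorem isIntegral_inv_of_aeval_eq_one {x : K} (hx : x ≠ 0) {p : A[X]} (hp : aeval x p = 1)
    (h0 : p.coeff 0 ∈ IsLocalRing.maximalIdeal A) : IsIntegral A x⁻¹ := by
  have hu : IsUnit ((1 - p).coeff 0) := by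
    rw [coeff_sub, coeff_one_zero]
    exact IsLocalRing.isUnit_one_sub_self_of_mem_nonunits _ h0
  have hroot : aeval x⁻¹ (1 - p).reverse = 0 := by
    have : Invertible x := invertibleOfNonzero hx
    rw [← invOf_eq_inv, aeval_def, eval₂_reverse_eq_zero_iff, ← aeval_def]
    simp [hp]
  have hlead : (1 - p).reverse.leadingCoeff = (1 - p).coeff 0 := by
    rw [reverse_leadingCoeff, trailingCoeff_eq_coeff_zero hu.ne_zero]
  have := isIntegral_leadingCoeff_smul _ _ hroot
  rw [hlead] at this
  obtain ⟨u, hu⟩ := hu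
  rw [← hu] at this
  simpa [smul_smul] using this.smul (↑u⁻¹ : A)

variable (K) in
/-- A local domain all of whose simple overrings are flat is a valuation ring. -/
theorem ValuationRing.of_flat_adjoin [IsDomain A] [IsFractionRing A K]
    (h : ∀ x : K, Module.Flat A (Algebra.adjoin A {x})) :
    ValuationRing A := by
  refine (ValuationRing.iff_isInteger_or_isInteger A K).2 fun x =>
    or_iff_not_imp_left.2 fun hx => ?_
  have hx0 : x ≠ 0 := by
    rintro rfl
    exact hx ⟨0, map_zero _⟩
  have := h x
  have := h x⁻¹
  obtain ⟨k, c, y, hy, hc, h1⟩ := (Algebra.adjoin A {x}).exists_sum_smul_eq_one_of_flat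
    (Algebra.self_mem_adjoin_singleton A x)
  simp_rw [Algebra.adjoin_singleton_eq_range_aeval, AlgHom.mem_range] at hy
  choose p hp using hy
  refine isInteger_of_isIntegral_of_flat
    (isIntegral_inv_of_aeval_eq_one hx0 (p := ∑ j, c j • p j) (by simp [hp, h1]) ?_)
  rw [finsetSum_coeff]
  refine Ideal.sum_mem _ fun j _ => ?_
  rw [coeff_smul, smul_eq_mul]
  exact Ideal.mul_mem_right _ _
    ((IsLocalRing.mem_maximalIdeal _).2 fun hu => hx ((hc j).of_isUnit_smul hu))

end FlatOverring

section FlatEpi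

variable {A B : Type*} [CommRing A] [CommRing B] [Algebra A B]

/-- A flat algebra all of whose elements are fractions over the base is an epimorphic extension. -/
theorem bijective_mul'_of_flat [IsDomain A] [Module.Flat A B]
    (h : ∀ b : B, ∃ a : A, a ≠ 0 ∧ ∃ c : A, a • b = algebraMap A B c) :
    Function.Bijective (LinearMap.mul' A B) := by
  refine ⟨(injective_iff_map_eq_zero _).2 fun z hz => ?_, fun b => ⟨1 ⊗ₜ b, by simp⟩⟩
  obtain ⟨a, ha, w, hw⟩ : ∃ a : A, a ≠ 0 ∧ ∃ w : B, a • z = 1 ⊗ₜ w := by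
    clear hz
    induction z with
    | zero => exact ⟨1, one_ne_zero, 0, by simp⟩
    | tmul x y =>
      obtain ⟨a, ha, c, hc⟩ := h x
      exact ⟨a, ha, c • y, by
        rw [smul_tmul', hc, Algebra.algebraMap_eq_smul_one, smul_tmul]⟩
    | add z₁ z₂ h₁ h₂ =>
      obtain ⟨a₁, ha₁, w₁, hw₁⟩ := h₁
      obtain ⟨a₂, ha₂, w₂, hw₂⟩ := h₂
      exact ⟨a₁ * a₂, mul_ne_zero ha₁ ha₂, a₂ • w₁ + a₁ • w₂, by
        rw [tmul_add, tmul_smul, tmul_smul, ← hw₁, ← hw₂, smul_add, smul_smul, smul_smul,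
          mul_comm a₁]⟩
  have hw0 : w = 0 := by
    have := congrArg (LinearMap.mul' A B) hw
    rwa [map_smul, hz, smul_zero, LinearMap.mul'_apply, one_mul, eq_comm] at this
  rw [hw0, tmul_zero] at hw
  exact (smul_eq_zero_iff_right ha).1 hw

end FlatEpi

section Localization

variable {R : Type*} [CommRing R] [IsDomain R] {K : Type*} [Field K] [Algebra R K]

/-- `R_𝔪` is a valuation ring iff any two elements of `R` are comparable under divisibility up to
a multiplier outside `𝔪`. -/
theorem valuationRing_iff_dvd_total (𝔪 : Ideal R) [𝔪.IsPrime] (A : Type*) [CommRing A]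
    [Algebra R A] [IsLocalization.AtPrime A 𝔪] [IsDomain A] :
    ValuationRing A ↔ ∀ a b : R, ∃ s ∉ 𝔪, a ∣ s * b ∨ b ∣ s * a := by
  have hinj : Function.Injective (algebraMap R A) :=
    IsLocalization.injective A 𝔪.primeCompl_le_nonZeroDivisors
  constructor
  · intro _ a b
    have aux : ∀ a b : R, algebraMap R A a ∣ algebraMap R A b → ∃ s ∉ 𝔪, a ∣ s * b := by
      rintro a b ⟨c, hc⟩
      obtain ⟨⟨d, s⟩, hd⟩ := IsLocalization.surj 𝔪.primeCompl c
      refine ⟨s, s.2, d, hinj ?_⟩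
      rw [map_mul, map_mul, ← hd, hc]
      ring
    rcases ValuationRing.dvd_total (algebraMap R A a) (algebraMap R A b) with hab | hab
    · exact (aux a b hab).imp fun _ h => ⟨h.1, Or.inl h.2⟩
    · exact (aux b a hab).imp fun _ h => ⟨h.1, Or.inr h.2⟩
  · refine fun h => ValuationRing.iff_dvd_total.2 ⟨fun x y => ?_⟩
    obtain ⟨⟨a, s⟩, hx⟩ := IsLocalization.surj 𝔪.primeCompl x
    obtain ⟨⟨b, t⟩, hy⟩ := IsLocalization.surj 𝔪.primeCompl y
    obtain ⟨r, hr, hab⟩ := h a b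
    have hunit : ∀ r ∉ 𝔪, IsUnit (algebraMap R A r) := fun r hr =>
      IsLocalization.map_units A (⟨r, hr⟩ : 𝔪.primeCompl)
    rw [← (hunit s s.2).dvd_mul_right (b := x), ← (hunit s s.2).mul_right_dvd (a := x),
      ← (hunit t t.2).dvd_mul_right (b := y), ← (hunit t t.2).mul_right_dvd (a := y), hx, hy,
      ← (hunit r hr).dvd_mul_left (b := algebraMap R A a),
      ← (hunit r hr).dvd_mul_left (b := algebraMap R A b), ← map_mul, ← map_mul]
    exact hab.imp (map_dvd _) (map_dvd _)

/-- If `R_𝔪` is a valuation ring, then `R_𝔪 → T_𝔪` is a flat epimorphism for every overring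
`T`. -/
theorem flat_and_bijective_mul'_of_valuationRing [IsFractionRing R K] (𝔪 : Ideal R) [𝔪.IsPrime]
    {A : Type*} [CommRing A] [Algebra R A] [IsLocalization.AtPrime A 𝔪] [IsDomain A]
    [ValuationRing A] (T : Subalgebra R K) {B : Type*} [CommRing B] [Algebra T B]
    [IsLocalization (𝔪.primeCompl.map (algebraMap R T)) B] [Algebra A B]
    (hAB : ∀ r, algebraMap A B (algebraMap R A r) = algebraMap T B (algebraMap R T r)) :
    Module.Flat A B ∧ Function.Bijective (LinearMap.mul' A B) := by
  have hRT : Function.Injective (algebraMap R T) := FaithfulSMul.algebraMap_injective R T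
  have hle : 𝔪.primeCompl.map (algebraMap R T) ≤ nonZeroDivisors T := by
    rintro _ ⟨s, hs, rfl⟩
    exact mem_nonZeroDivisors_of_ne_zero
      ((map_ne_zero_iff _ hRT).2 fun h => hs (h ▸ 𝔪.zero_mem))
  have hTB : Function.Injective (algebraMap T B) := IsLocalization.injective B hle
  have : IsDomain B := IsLocalization.isDomain_of_le_nonZeroDivisors _ hle
  have hinj : Function.Injective (algebraMap R A) :=
    IsLocalization.injective A 𝔪.primeCompl_le_nonZeroDivisors
  have hABinj : Function.Injective (algebraMap A B) := by
    refine (injective_iff_map_eq_zero _).2 fun x hx => ?_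
    obtain ⟨⟨a, s⟩, h⟩ := IsLocalization.surj 𝔪.primeCompl x
    have h0 : algebraMap T B (algebraMap R T a) = 0 := by
      rw [← hAB, ← h, map_mul, hx, zero_mul]
    have ha : a = 0 := hRT (hTB (by rw [h0, map_zero, map_zero]))
    dsimp only at h
    rw [ha, map_zero] at h
    exact (IsLocalization.map_units A s).mul_left_eq_zero.1 h
  have : FaithfulSMul A B := (faithfulSMul_iff_algebraMap_injective A B).2 hABinj
  have hflat : Module.Flat A B := by
    rw [Module.Flat.flat_iff_torsion_eq_bot_of_isBezout,
      ← Submodule.isTorsionFree_iff_torsion_eq_bot]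
    infer_instance
  refine ⟨hflat, bijective_mul'_of_flat fun b => ?_⟩
  obtain ⟨⟨t, ⟨_, s, hs, rfl⟩⟩, hb⟩ :=
    IsLocalization.surj (𝔪.primeCompl.map (algebraMap R T)) b
  obtain ⟨p, q, hq, hpq⟩ := IsFractionRing.div_surjective (A := R) (t : K)
  have hq0 := nonZeroDivisors.ne_zero hq
  have ht : algebraMap R T q * t = algebraMap R T p := by
    refine Subtype.ext ?_
    change algebraMap R K q * t = algebraMap R K p
    rw [← hpq, mul_div_cancel₀]
    simpa using hq0
  refine ⟨algebraMap R A (q * s), (map_ne_zero_iff _ hinj).2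
    (mul_ne_zero hq0 fun h => hs (h ▸ 𝔪.zero_mem)), algebraMap R A p, ?_⟩
  dsimp only at hb
  rw [Algebra.smul_def, hAB, hAB, ← ht, map_mul, map_mul, map_mul, ← hb]
  ring

omit [IsDomain R] in
/-- If `R[x]_𝔪` is flat over `R_𝔪`, then so is the simple overring `R_𝔪[x]`. -/
theorem flat_adjoin_singleton_of_flat [FaithfulSMul R K] (𝔪 : Ideal R) [𝔪.IsPrime]
    {A : Type*} [CommRing A] [Algebra R A] [IsLocalization.AtPrime A 𝔪] [Algebra A K]
    [IsScalarTower R A K] (x : K) {T : Subalgebra R K} (hT : T = Algebra.adjoin R {x})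
    {B : Type*} [CommRing B] [Algebra T B]
    [IsLocalization (𝔪.primeCompl.map (algebraMap R T)) B] [Algebra A B]
    (hAB : ∀ r, algebraMap A B (algebraMap R A r) = algebraMap T B (algebraMap R T r))
    [Module.Flat A B] : Module.Flat A (Algebra.adjoin A {x}) := by
  have hunit : ∀ s : 𝔪.primeCompl.map (algebraMap R T), IsUnit (algebraMap T K s) := by
    rintro ⟨_, s, hs, rfl⟩
    refine isUnit_iff_ne_zero.2 ?_
    rw [← IsScalarTower.algebraMap_apply]
    exact (map_ne_zero_iff _ (FaithfulSMul.algebraMap_injective R K)).2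
      fun h => hs (h ▸ 𝔪.zero_mem)
  let f : B →+* K := IsLocalization.lift hunit
  have hf : ∀ t : T, f (algebraMap T B t) = t := fun t => IsLocalization.lift_eq hunit t
  have hfA : ∀ a : A, f (algebraMap A B a) = algebraMap A K a := by
    refine RingHom.congr_fun (f := f.comp (algebraMap A B))
      (IsLocalization.ringHom_ext 𝔪.primeCompl (RingHom.ext fun r => ?_))
    simp only [RingHom.comp_apply, hAB, hf, ← IsScalarTower.algebraMap_apply]
    rfl
  have hinj : Function.Injective f := by
    refine (IsLocalization.lift_injective_iff hunit).2 fun a b => ⟨fun h => ?_, fun h => ?_⟩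
    · have := congrArg f h
      rwa [hf, hf] at this
    · exact congrArg _ (Subtype.ext h)
  let F : B →ₐ[A] K := { f with commutes' := hfA }
  have hrange : F.range = Algebra.adjoin A {x} := by
    refine le_antisymm ?_ (Algebra.adjoin_le (Set.singleton_subset_iff.2 ?_))
    · rintro _ ⟨b, rfl⟩
      obtain ⟨⟨t, ⟨_, s, hs, rfl⟩⟩, hb⟩ :=
        IsLocalization.surj (𝔪.primeCompl.map (algebraMap R T)) b
      obtain ⟨u, hu⟩ := IsLocalization.map_units A (⟨s, hs⟩ : 𝔪.primeCompl)
      dsimp only at hb hu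
      have hFb : F b = (↑u⁻¹ : A) • (t : K) := by
        have h1 : algebraMap A K u * F b = t :=
          calc algebraMap A K u * F b = f (algebraMap A B u * b) := by rw [map_mul, hfA]; rfl
            _ = f (algebraMap T B t) := by rw [hu, hAB, mul_comm, hb]
            _ = t := hf t
        rw [← h1, ← Algebra.smul_def, smul_smul, Units.inv_mul, one_smul]
      have htmem : (t : K) ∈ Algebra.adjoin A {x} := by
        have : (t : K) ∈ Algebra.adjoin R {x} := hT.le t.2
        have hle : Algebra.adjoin R {x} ≤ (Algebra.adjoin A {x}).restrictScalars R :=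
          Algebra.adjoin_le (Set.singleton_subset_iff.2 (Algebra.self_mem_adjoin_singleton A x))
        exact hle this
      exact Set.mem_of_eq_of_mem (s := (Algebra.adjoin A {x} : Set K)) hFb
        (Subalgebra.smul_mem _ htmem _)
    · exact ⟨algebraMap T B ⟨x, hT.ge <| Algebra.self_mem_adjoin_singleton R x⟩, hf _⟩
  rw [← hrange]
  exact Module.Flat.of_linearEquiv (AlgEquiv.ofInjective F hinj).symm.toLinearEquiv

end Localization

set_option synthInstance.maxHeartbeats 1000000 in
set_option maxHeartbeats 1000000 in
/-- `R` is a PvMD iff for every intermediate ring `R ⊆ T ⊆ K` and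
every maximal `w`-ideal `𝔪` (which is prime), the natural map `R_𝔪 → T_𝔪` is a flat
ring epimorphism: `T_𝔪` is flat over `R_𝔪` and `T_𝔪 ⊗_{R_𝔪} T_𝔪 → T_𝔪` is bijective. -/
theorem pvmd_iff_overring_localization_flat_epi
    {R : Type u} [CommRing R] [IsDomain R]
    (K : Type u) [Field K] [Algebra R K] [IsFractionRing R K] :
    IsPvMD R K ↔
      ∀ (T : Subalgebra R K) (𝔪 : Ideal R), IsMaximalWIdeal 𝔪 → ∀ (hp : 𝔪.IsPrime),
        haveI := hp
        letI : Algebra (Localization 𝔪.primeCompl)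
            (Localization (Submonoid.map (algebraMap R T) 𝔪.primeCompl)) :=
          (IsLocalization.map
            (Localization (Submonoid.map (algebraMap R T) 𝔪.primeCompl))
            (algebraMap R T) (Submonoid.le_comap_map 𝔪.primeCompl) :
              Localization 𝔪.primeCompl →+*
                Localization (Submonoid.map (algebraMap R T) 𝔪.primeCompl)).toAlgebra
        Module.Flat (Localization 𝔪.primeCompl)
          (Localization (Submonoid.map (algebraMap R T) 𝔪.primeCompl)) ∧
        Function.Bijective (LinearMap.mul' (Localization 𝔪.primeCompl)
          (Localization (Submonoid.map (algebraMap R T) 𝔪.primeCompl))) := by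
  constructor
  · intro h T 𝔪 hm hp
    let : Algebra (Localization 𝔪.primeCompl)
        (Localization (Submonoid.map (algebraMap R T) 𝔪.primeCompl)) :=
      (IsLocalization.map
        (Localization (Submonoid.map (algebraMap R T) 𝔪.primeCompl))
        (algebraMap R T) (Submonoid.le_comap_map 𝔪.primeCompl) :
          Localization 𝔪.primeCompl →+*
            Localization (Submonoid.map (algebraMap R T) 𝔪.primeCompl)).toAlgebra
    have : IsDomain (Localization 𝔪.primeCompl) :=
      IsLocalization.isDomain_localization 𝔪.primeCompl_le_nonZeroDivisors
    have : ValuationRing (Localization 𝔪.primeCompl) :=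
      (valuationRing_iff_dvd_total 𝔪 _).2 (h.dvd_total hm)
    exact flat_and_bijective_mul'_of_valuationRing 𝔪 T fun r => IsLocalization.map_eq _ r
  · refine fun h => isPvMD_of_dvd_total fun 𝔪 hm hp => ?_
    have : IsDomain (Localization 𝔪.primeCompl) :=
      IsLocalization.isDomain_localization 𝔪.primeCompl_le_nonZeroDivisors
    have : IsLocalRing (Localization 𝔪.primeCompl) := Localization.AtPrime.isLocalRing 𝔪
    have hunit : ∀ s : 𝔪.primeCompl, IsUnit (algebraMap R K s) := fun s =>
      isUnit_iff_ne_zero.2 ((map_ne_zero_iff _ (IsFractionRing.injective R K)).2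
        fun h0 => s.2 (h0 ▸ 𝔪.zero_mem))
    let : Algebra (Localization 𝔪.primeCompl) K := (IsLocalization.lift hunit).toAlgebra
    have : IsScalarTower R (Localization 𝔪.primeCompl) K :=
      IsScalarTower.of_algebraMap_eq fun r => (IsLocalization.lift_eq hunit r).symm
    have : IsFractionRing (Localization 𝔪.primeCompl) K :=
      IsFractionRing.isFractionRing_of_isDomain_of_isLocalization 𝔪.primeCompl _ K
    refine (valuationRing_iff_dvd_total 𝔪 (Localization 𝔪.primeCompl)).1
      (ValuationRing.of_flat_adjoin K fun x => ?_)
    let : Algebra (Localization 𝔪.primeCompl)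
        (Localization (Submonoid.map (algebraMap R (Algebra.adjoin R {x})) 𝔪.primeCompl)) :=
      (IsLocalization.map
        (Localization (Submonoid.map (algebraMap R (Algebra.adjoin R {x})) 𝔪.primeCompl))
        (algebraMap R (Algebra.adjoin R {x})) (Submonoid.le_comap_map 𝔪.primeCompl) :
          Localization 𝔪.primeCompl →+*
            Localization (Submonoid.map (algebraMap R (Algebra.adjoin R {x}))
              𝔪.primeCompl)).toAlgebra
    have hflat : Module.Flat (Localization 𝔪.primeCompl) (Localization
        (Submonoid.map (algebraMap R (Algebra.adjoin R {x})) 𝔪.primeCompl)) :=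
      (h (Algebra.adjoin R {x}) 𝔪 hm hp).1
    exact flat_adjoin_singleton_of_flat 𝔪 x rfl (B := Localization
      (Submonoid.map (algebraMap R (Algebra.adjoin R {x})) 𝔪.primeCompl))
      fun r => IsLocalization.map_eq _ r
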